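/- (Theorem 3.12) If the presentation Γ,Δ ⊢ is derivable in the unpolarized sequent calculus for LG∅ (respectively LG_I, CNL), then the presentation ⌊Γ⌋,⌊Δ⌋ ⊢ is derivable in the polarized sequent calculus LG∅^pol (respectively with the corresponding LG_I or CNL structural rules added). -/

import Mathlib

/-- Unpolarized formulas of LG/CNL.  `ldiv B A` denotes `B\A`, `lsub B A` denotes `B⦸A`,
`rdiv A B` denotes `A/B`, `rsub A B` denotes `A⊘B`. -/
inductive Fm : Type
  | pos : Nat → Fm                -- positive atom p
  | neg : Nat → Fm                -- negative atom p̄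
  | tens : Fm → Fm → Fm           -- A ⊗ B
  | par : Fm → Fm → Fm            -- A ⊕ B
  | rdiv : Fm → Fm → Fm           -- A / B
  | ldiv : Fm → Fm → Fm           -- B \ A  (ldiv B A)
  | rsub : Fm → Fm → Fm           -- A ⊘ B
  | lsub : Fm → Fm → Fm           -- B ⦸ A  (lsub B A)
  | conj : Fm → Fm → Fm           -- A ∧ B
  | disj : Fm → Fm → Fm           -- A ∨ B

/-- Linear negation. -/
def Fm.dual : Fm → Fm
  | .pos n => .neg n
  | .neg n => .pos n
  | .tens A B => .par B.dual A.dual        -- (A⊗B)⊥ = B⊥⊕A⊥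
  | .par A B => .tens B.dual A.dual        -- (A⊕B)⊥ = B⊥⊗A⊥
  | .rdiv A B => .lsub B.dual A.dual       -- (A/B)⊥ = B⊥⦸A⊥
  | .lsub B A => .rdiv A.dual B.dual       -- (B⦸A)⊥ = A⊥/B⊥
  | .ldiv B A => .rsub A.dual B.dual       -- (B\A)⊥ = A⊥⊘B⊥
  | .rsub A B => .ldiv B.dual A.dual       -- (A⊘B)⊥ = B⊥\A⊥
  | .conj A B => .disj B.dual A.dual       -- (A∧B)⊥ = B⊥∨A⊥
  | .disj A B => .conj B.dual A.dual       -- (A∨B)⊥ = B⊥∧A⊥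
/-- Structures: Γ ::= A | Γ·⊗·Δ | Γ·⊘·Δ | Δ·⦸·Γ.
`slsub Δ Γ` denotes `Δ·⦸·Γ`, `srsub Γ Δ` denotes `Γ·⊘·Δ`. -/
inductive Str : Type
  | fm : Fm → Str
  | stens : Str → Str → Str
  | srsub : Str → Str → Str
  | slsub : Str → Str → Str

mutual
/-- The positive formula interpretation Γ⁺ of a structure. -/
def Str.posF : Str → Fm
  | .fm A => A
  | .stens Γ Δ => .tens Γ.posF Δ.posF
  | .srsub Γ Δ => .rsub Γ.posF Δ.negF
  | .slsub Δ Γ => .lsub Δ.negF Γ.posF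
/-- The negative formula interpretation Γ⁻ of a structure. -/
def Str.negF : Str → Fm
  | .fm A => A.dual
  | .stens Γ Δ => .par Δ.negF Γ.negF
  | .srsub Γ Δ => .ldiv Δ.posF Γ.negF
  | .slsub Δ Γ => .rdiv Γ.negF Δ.posF
end

/-- One-sided sequent derivability `DSeq g c Γ Δ` of the presentation `Γ,Δ ⊢`.
The flag `g` enables the Grishin (linear distributivity) structural rules of LG_I,
the flag `c` enables the CNL structural rules.  Thus `DSeq false false` is LG∅,
`DSeq true false` is LG_I, and `DSeq false true` is CNL. -/
inductive DSeq : Bool → Bool → Str → Str → Prop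
  | ax {g c A} : DSeq g c (.fm A) (.fm A.dual)
  | cut {g c Γ Δ A} : DSeq g c Δ (.fm A) → DSeq g c Γ (.fm A.dual) → DSeq g c Γ Δ
  | sym {g c Γ Δ} : DSeq g c Γ Δ → DSeq g c Δ Γ
  | dp1 {g c Γ Δ Θ} : DSeq g c (.stens Γ Δ) Θ → DSeq g c Γ (.slsub Δ Θ)
  | dp1' {g c Γ Δ Θ} : DSeq g c Γ (.slsub Δ Θ) → DSeq g c (.stens Γ Δ) Θ
  | dp2 {g c Γ Δ Θ} : DSeq g c Γ (.stens Δ Θ) → DSeq g c (.srsub Γ Δ) Θ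
  | dp2' {g c Γ Δ Θ} : DSeq g c (.srsub Γ Δ) Θ → DSeq g c Γ (.stens Δ Θ)
  | tensL {g c Γ A B} : DSeq g c Γ (.stens (.fm A) (.fm B)) → DSeq g c Γ (.fm (.tens A B))
  | lsubL {g c Γ A B} : DSeq g c Γ (.slsub (.fm B.dual) (.fm A)) → DSeq g c Γ (.fm (.lsub B A))
  | rsubL {g c Γ A B} : DSeq g c Γ (.srsub (.fm A) (.fm B.dual)) → DSeq g c Γ (.fm (.rsub A B))
  | parL {g c Γ Δ A B} : DSeq g c Γ (.fm A) → DSeq g c Δ (.fm B) →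
      DSeq g c (.stens Δ Γ) (.fm (.par A B))
  | rdivL {g c Γ Δ A B} : DSeq g c Δ (.fm B.dual) → DSeq g c Γ (.fm A) →
      DSeq g c (.slsub Δ Γ) (.fm (.rdiv A B))
  | ldivL {g c Γ Δ A B} : DSeq g c Δ (.fm B.dual) → DSeq g c Γ (.fm A) →
      DSeq g c (.srsub Γ Δ) (.fm (.ldiv B A))
  | conjL1 {g c Γ A B} : DSeq g c Γ (.fm A) → DSeq g c Γ (.fm (.conj A B))
  | conjL2 {g c Γ A B} : DSeq g c Γ (.fm B) → DSeq g c Γ (.fm (.conj A B))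
  | disjL {g c Γ A B} : DSeq g c Γ (.fm A) → DSeq g c Γ (.fm B) → DSeq g c Γ (.fm (.disj A B))
  -- Grishin structural rules (LG_I)
  | gr1 {c Γ₁ Γ₂ Δ₁ Δ₂} : DSeq true c (.srsub Γ₂ Δ₂) (.srsub Δ₁ Γ₁) →
      DSeq true c (.stens Γ₁ Γ₂) (.stens Δ₂ Δ₁)
  | gr2 {c Γ₁ Γ₂ Δ₁ Δ₂} : DSeq true c (.slsub Δ₁ Γ₁) (.slsub Γ₂ Δ₂) →
      DSeq true c (.stens Γ₁ Γ₂) (.stens Δ₂ Δ₁)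
  | gr3 {c Γ₁ Γ₂ Δ₁ Δ₂} : DSeq true c (.srsub Δ₂ Γ₁) (.slsub Δ₁ Γ₂) →
      DSeq true c (.stens Γ₁ Γ₂) (.stens Δ₂ Δ₁)
  -- CNL structural rules
  | cnl1 {g Γ Δ Θ} : DSeq g true Γ (.srsub Δ Θ) → DSeq g true Γ (.stens Δ Θ)
  | cnl1' {g Γ Δ Θ} : DSeq g true Γ (.stens Δ Θ) → DSeq g true Γ (.srsub Δ Θ)
  | cnl2 {g Γ Δ Θ} : DSeq g true Γ (.slsub Δ Θ) → DSeq g true Γ (.stens Δ Θ)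
  | cnl2' {g Γ Δ Θ} : DSeq g true Γ (.stens Δ Θ) → DSeq g true Γ (.slsub Δ Θ)
mutual
/-- Positive polarized formulas.  `rsub P N` denotes `P⊘N`, `lsub N P` denotes `N⦸P`. -/
inductive PFm : Type
  | pos : Nat → PFm               -- atom p
  | tens : PFm → PFm → PFm        -- P ⊗ Q
  | rsub : PFm → NFm → PFm        -- P ⊘ N
  | lsub : NFm → PFm → PFm        -- N ⦸ P
  | disj : PFm → PFm → PFm        -- P ∨ Q
  | down : NFm → PFm              -- ↓N
/-- Negative polarized formulas.  `rdiv M Q` denotes `M/Q`, `ldiv Q M` denotes `Q\M`. -/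
inductive NFm : Type
  | neg : Nat → NFm               -- atom p̄
  | par : NFm → NFm → NFm         -- M ⊕ N
  | ldiv : PFm → NFm → NFm        -- Q \ M
  | rdiv : NFm → PFm → NFm        -- M / Q
  | conj : NFm → NFm → NFm        -- M ∧ N
  | up : PFm → NFm                -- ↑P
end

mutual
/-- Polarized linear negation (positive to negative). -/
def PFm.dual : PFm → NFm
  | .pos n => .neg n
  | .tens P Q => .par Q.dual P.dual        -- (P⊗Q)⊥ = Q⊥⊕P⊥
  | .rsub P N => .ldiv N.dual P.dual       -- (P⊘N)⊥ = N⊥\P⊥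
  | .lsub N P => .rdiv P.dual N.dual       -- (N⦸P)⊥ = P⊥/N⊥
  | .disj P Q => .conj Q.dual P.dual       -- (P∨Q)⊥ = Q⊥∧P⊥
  | .down N => .up N.dual                  -- (↓N)⊥ = ↑(N⊥)
/-- Polarized linear negation (negative to positive). -/
def NFm.dual : NFm → PFm
  | .neg n => .pos n
  | .par M N => .tens N.dual M.dual        -- (M⊕N)⊥ = N⊥⊗M⊥
  | .ldiv Q M => .rsub M.dual Q.dual       -- (Q\M)⊥ = M⊥⊘Q⊥
  | .rdiv M Q => .lsub Q.dual M.dual       -- (M/Q)⊥ = Q⊥⦸M⊥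
  | .conj M N => .disj N.dual M.dual       -- (M∧N)⊥ = N⊥∨M⊥
  | .up P => .down P.dual                  -- (↑P)⊥ = ↓(P⊥)
end
/-- The polarity ε of an unpolarized formula: `true` (positive) for `p`, `⊗`, `⊘`, `⦸`
(and the additive disjunction `∨`, which decorates to a positive polarized formula),
`false` (negative) otherwise. -/
def Fm.eps : Fm → Bool
  | .pos _ => true
  | .tens _ _ => true
  | .rsub _ _ => true
  | .lsub _ _ => true
  | .disj _ _ => true
  | _ => false

mutual
/-- `decP A` is `A'`: the shift decoration `⌊A⌋` if `ε(A)=+`, and `↓⌊A⌋` if `ε(A)=−`.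
In particular, for positive `A`, `⌊A⌋ = decP A`. -/
def decP : Fm → PFm
  | .pos n => .pos n
  | .neg n => .down (.neg n)
  | .tens A B => .tens (decP A) (decP B)           -- ⌊A⊗B⌋ = A'⊗B'
  | .rsub A B => .rsub (decP A) (decN B)           -- ⌊A⊘B⌋ = A'⊘B''
  | .lsub B A => .lsub (decN B) (decP A)           -- ⌊B⦸A⌋ = B''⦸A'
  | .disj A B => .disj (decP A) (decP B)           -- ⌊A∨B⌋ = A'∨B'
  | .par A B => .down (.par (decN A) (decN B))     -- ⌊A⊕B⌋ = A''⊕B''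
  | .ldiv B A => .down (.ldiv (decP B) (decN A))   -- ⌊B\A⌋ = B'\A''
  | .rdiv A B => .down (.rdiv (decN A) (decP B))   -- ⌊A/B⌋ = A''/B'
  | .conj A B => .down (.conj (decN A) (decN B))   -- ⌊A∧B⌋ = A''∧B''
/-- `decN A` is `A''`: the shift decoration `⌊A⌋` if `ε(A)=−`, and `↑⌊A⌋` if `ε(A)=+`.
In particular, for negative `A`, `⌊A⌋ = decN A`. -/
def decN : Fm → NFm
  | .pos n => .up (.pos n)
  | .neg n => .neg n
  | .tens A B => .up (.tens (decP A) (decP B))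
  | .rsub A B => .up (.rsub (decP A) (decN B))
  | .lsub B A => .up (.lsub (decN B) (decP A))
  | .disj A B => .up (.disj (decP A) (decP B))
  | .par A B => .par (decN A) (decN B)
  | .ldiv B A => .ldiv (decP B) (decN A)
  | .rdiv A B => .rdiv (decN A) (decP B)
  | .conj A B => .conj (decN A) (decN B)
end
/-- Polarized structures, containing only positive formulas.
`slsub Δ Γ` denotes `Δ·⦸·Γ`, `srsub Γ Δ` denotes `Γ·⊘·Δ`. -/
inductive PStr : Type
  | fm : PFm → PStr
  | stens : PStr → PStr → PStr
  | srsub : PStr → PStr → PStr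
  | slsub : PStr → PStr → PStr

mutual
/-- The positive formula interpretation Γ⁺ of a polarized structure. -/
def PStr.posF : PStr → PFm
  | .fm P => P
  | .stens Γ Δ => .tens Γ.posF Δ.posF
  | .srsub Γ Δ => .rsub Γ.posF Δ.negF
  | .slsub Δ Γ => .lsub Δ.negF Γ.posF
/-- The negative formula interpretation Γ⁻ of a polarized structure. -/
def PStr.negF : PStr → NFm
  | .fm P => P.dual
  | .stens Γ Δ => .par Δ.negF Γ.negF
  | .srsub Γ Δ => .ldiv Δ.posF Γ.negF
  | .slsub Δ Γ => .rdiv Γ.negF Δ.posF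
end
/-- The shift decoration on structures: each formula occurrence `A` is replaced by `A'`
(i.e. `⌊A⌋` if `ε(A)=+`, and `↓⌊A⌋` if `ε(A)=−`). -/
def decS : Str → PStr
  | .fm A => .fm (decP A)
  | .stens Γ Δ => .stens (decS Γ) (decS Δ)
  | .srsub Γ Δ => .srsub (decS Γ) (decS Δ)
  | .slsub Δ Γ => .slsub (decS Δ) (decS Γ)
mutual
/-- The polarized sequent calculus, presentation judgement `Γ,Δ ⊢`, with flags:
`g` enables the Grishin (LG_I) structural rules and `c` enables the CNL structural rules;
`PSeqF false false` is LG∅^pol. -/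
inductive PSeqF : Bool → Bool → PStr → PStr → Prop
  | cut {g c Γ Δ P} : PStoupF g c Δ P → PSeqF g c Γ (.fm P) → PSeqF g c Γ Δ
  | downL {g c Γ N} : PStoupF g c Γ N.dual → PSeqF g c Γ (.fm (.down N))
  | tensL {g c Γ P Q} : PSeqF g c Γ (.stens (.fm P) (.fm Q)) → PSeqF g c Γ (.fm (.tens P Q))
  | lsubL {g c Γ N P} : PSeqF g c Γ (.slsub (.fm N.dual) (.fm P)) → PSeqF g c Γ (.fm (.lsub N P))
  | rsubL {g c Γ P N} : PSeqF g c Γ (.srsub (.fm P) (.fm N.dual)) → PSeqF g c Γ (.fm (.rsub P N))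
  | disjL {g c Γ P Q} : PSeqF g c Γ (.fm P) → PSeqF g c Γ (.fm Q) → PSeqF g c Γ (.fm (.disj P Q))
  | sym {g c Γ Δ} : PSeqF g c Γ Δ → PSeqF g c Δ Γ
  | dp1 {g c Γ Δ Θ} : PSeqF g c (.stens Γ Δ) Θ → PSeqF g c Γ (.slsub Δ Θ)
  | dp1' {g c Γ Δ Θ} : PSeqF g c Γ (.slsub Δ Θ) → PSeqF g c (.stens Γ Δ) Θ
  | dp2 {g c Γ Δ Θ} : PSeqF g c Γ (.stens Δ Θ) → PSeqF g c (.srsub Γ Δ) Θ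
  | dp2' {g c Γ Δ Θ} : PSeqF g c (.srsub Γ Δ) Θ → PSeqF g c Γ (.stens Δ Θ)
  -- Grishin structural rules (LG_I)
  | gr1 {c Γ₁ Γ₂ Δ₁ Δ₂} : PSeqF true c (.srsub Γ₂ Δ₂) (.srsub Δ₁ Γ₁) →
      PSeqF true c (.stens Γ₁ Γ₂) (.stens Δ₂ Δ₁)
  | gr2 {c Γ₁ Γ₂ Δ₁ Δ₂} : PSeqF true c (.slsub Δ₁ Γ₁) (.slsub Γ₂ Δ₂) →
      PSeqF true c (.stens Γ₁ Γ₂) (.stens Δ₂ Δ₁)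
  | gr3 {c Γ₁ Γ₂ Δ₁ Δ₂} : PSeqF true c (.srsub Δ₂ Γ₁) (.slsub Δ₁ Γ₂) →
      PSeqF true c (.stens Γ₁ Γ₂) (.stens Δ₂ Δ₁)
  -- CNL structural rules
  | cnl1 {g Γ Δ Θ} : PSeqF g true Γ (.srsub Δ Θ) → PSeqF g true Γ (.stens Δ Θ)
  | cnl1' {g Γ Δ Θ} : PSeqF g true Γ (.stens Δ Θ) → PSeqF g true Γ (.srsub Δ Θ)
  | cnl2 {g Γ Δ Θ} : PSeqF g true Γ (.slsub Δ Θ) → PSeqF g true Γ (.stens Δ Θ)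
  | cnl2' {g Γ Δ Θ} : PSeqF g true Γ (.stens Δ Θ) → PSeqF g true Γ (.slsub Δ Θ)
/-- The polarized sequent calculus, stoup judgement `Γ ⊢ P`, with flags. -/
inductive PStoupF : Bool → Bool → PStr → PFm → Prop
  | id {g c P} : PStoupF g c (.fm P) P
  | downR {g c Γ N} : PSeqF g c Γ (.fm N.dual) → PStoupF g c Γ (.down N)
  | tensR {g c Γ Δ P Q} : PStoupF g c Γ P → PStoupF g c Δ Q →
      PStoupF g c (.stens Γ Δ) (.tens P Q)
  | lsubR {g c Γ Δ N P} : PStoupF g c Δ N.dual → PStoupF g c Γ P →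
      PStoupF g c (.slsub Δ Γ) (.lsub N P)
  | rsubR {g c Γ Δ N P} : PStoupF g c Δ N.dual → PStoupF g c Γ P →
      PStoupF g c (.srsub Γ Δ) (.rsub P N)
  | disjRl {g c Γ P Q} : PStoupF g c Γ P → PStoupF g c Γ (.disj P Q)
  | disjRr {g c Γ P Q} : PStoupF g c Γ Q → PStoupF g c Γ (.disj P Q)
end

theorem Fm.dd : ∀ A : Fm, A.dual.dual = A := by
  intro A; induction A <;> simp_all [Fm.dual]

mutual
theorem PFm.dd : ∀ P : PFm, P.dual.dual = P
  | .pos n => by simp [PFm.dual, NFm.dual]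
  | .tens P Q => by simp [PFm.dual, NFm.dual, PFm.dd P, PFm.dd Q]
  | .rsub P N => by simp [PFm.dual, NFm.dual, PFm.dd P, NFm.dd N]
  | .lsub N P => by simp [PFm.dual, NFm.dual, PFm.dd P, NFm.dd N]
  | .disj P Q => by simp [PFm.dual, NFm.dual, PFm.dd P, PFm.dd Q]
  | .down N => by simp [PFm.dual, NFm.dual, NFm.dd N]
theorem NFm.dd : ∀ N : NFm, N.dual.dual = N
  | .neg n => by simp [PFm.dual, NFm.dual]
  | .par M N => by simp [PFm.dual, NFm.dual, NFm.dd M, NFm.dd N]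
  | .ldiv Q M => by simp [PFm.dual, NFm.dual, NFm.dd M, PFm.dd Q]
  | .rdiv M Q => by simp [PFm.dual, NFm.dual, NFm.dd M, PFm.dd Q]
  | .conj M N => by simp [PFm.dual, NFm.dual, NFm.dd M, NFm.dd N]
  | .up P => by simp [PFm.dual, NFm.dual, PFm.dd P]
end

theorem dec_dual (A : Fm) : decP A.dual = (decN A).dual ∧ decN A.dual = (decP A).dual := by
  induction A <;> simp_all [Fm.dual, decP, decN, PFm.dual, NFm.dual]

theorem dec_cases (A : Fm) :
    decN A = .up (decP A) ∨ decP A = .down (decN A) := by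
  cases A <;> simp [decP, decN]

theorem pax {g c : Bool} (A : Fm) : PSeqF g c (.fm (decP A)) (.fm (decP A.dual)) := by
  rw [(dec_dual A).1]
  rcases dec_cases A with h | h
  · rw [h]; simp only [NFm.dual]
    exact .downL (by rw [PFm.dd]; exact .id)
  · rw [h]
    exact .sym (.downL .id)

theorem pcut {g c : Bool} {Γ Δ : PStr} (A : Fm) (h1 : PSeqF g c Δ (.fm (decP A)))
    (h2 : PSeqF g c Γ (.fm (decP A.dual))) : PSeqF g c Γ Δ := by
  rw [(dec_dual A).1] at h2
  rcases dec_cases A with h | h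
  · rw [h] at h2; simp only [NFm.dual] at h2
    exact .cut (.downR (by rw [PFm.dd]; exact h1)) h2
  · rw [h] at h1
    exact .sym (.cut (.downR h2) h1)

/-- Theorem 3.12: if `Γ,Δ ⊢` is derivable in the unpolarized sequent
calculus for LG∅ (`g = c = false`), LG_I (`g = true`) or CNL (`c = true`), then
`⌊Γ⌋,⌊Δ⌋ ⊢` is derivable in the polarized sequent calculus with the corresponding
structural rules. -/
theorem unpolarized_to_polarized (g c : Bool) (Γ Δ : Str) (h : DSeq g c Γ Δ) :
    PSeqF g c (decS Γ) (decS Δ) := by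
  induction h with
  | ax => exact pax _
  | cut _ _ h1 h2 => exact pcut _ h1 h2
  | sym _ h => exact .sym h
  | dp1 _ h => exact .dp1 h
  | dp1' _ h => exact .dp1' h
  | dp2 _ h => exact .dp2 h
  | dp2' _ h => exact .dp2' h
  | tensL _ h => exact .tensL h
  | @lsubL g c Γ A B _ h =>
    simp only [decS, decP, (dec_dual B).1] at h ⊢
    exact .lsubL h
  | @rsubL g c Γ A B _ h =>
    simp only [decS, decP, (dec_dual B).1] at h ⊢
    exact .rsubL h
  | @parL g c Γ Δ A B _ _ h1 h2 =>
    simp only [decS, decP] at h1 h2 ⊢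
    have h0 : PSeqF g c (.stens (.fm (decP B.dual)) (.fm (decP A.dual)))
        (.fm (.down (.par (decN A) (decN B)))) := by
      rw [(dec_dual A).1, (dec_dual B).1]
      exact .downL (.tensR .id .id)
    have k1 := pcut B h2 (.sym (.dp1 h0))
    have k2 := pcut A h1 (.dp2 (.sym (.dp1' (.sym k1))))
    exact .sym (.dp2' k2)
  | @rdivL g c Γ Δ A B _ _ h1 h2 =>
    simp only [decS, decP] at h1 h2 ⊢
    have h0 : PSeqF g c (.slsub (.fm (decP B)) (.fm (decP A.dual)))
        (.fm (.down (.rdiv (decN A) (decP B)))) := by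
      rw [(dec_dual A).1]
      exact .downL (.lsubR (by rw [PFm.dd]; exact .id) .id)
    have k1 := pcut A h2 (.dp1' (.sym h0))
    have k2 := pcut B.dual h1 (by rw [Fm.dd]; exact .dp2 (.sym (.dp1' (.dp1 k1))))
    exact .sym (.dp1 (.sym (.dp2' k2)))
  | @ldivL g c Γ Δ A B _ _ h1 h2 =>
    simp only [decS, decP] at h1 h2 ⊢
    have h0 : PSeqF g c (.srsub (.fm (decP A.dual)) (.fm (decP B)))
        (.fm (.down (.ldiv (decP B) (decN A)))) := by
      rw [(dec_dual A).1]
      exact .downL (.rsubR (by rw [PFm.dd]; exact .id) .id)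
    have k1 := pcut A h2 (.sym (.dp2' h0))
    have k2 := pcut B.dual h1 (by rw [Fm.dd]; exact .sym (.dp1 k1))
    exact .dp2 (.sym (.dp1' (.sym k2)))
  | @conjL1 g c Γ A B _ h =>
    simp only [decS, decP] at h ⊢
    refine .sym (pcut A h ?_)
    rw [(dec_dual A).1]
    exact .sym (.downL (.disjRr .id))
  | @conjL2 g c Γ A B _ h =>
    simp only [decS, decP] at h ⊢
    refine .sym (pcut B h ?_)
    rw [(dec_dual B).1]
    exact .sym (.downL (.disjRl .id))
  | disjL _ _ h1 h2 => exact .disjL h1 h2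
  | gr1 _ h => exact .gr1 h
  | gr2 _ h => exact .gr2 h
  | gr3 _ h => exact .gr3 h
  | cnl1 _ h => exact .cnl1 h
  | cnl1' _ h => exact .cnl1' h
  | cnl2 _ h => exact .cnl2 h
  | cnl2' _ h => exact .cnl2' h
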